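/- arXiv:1706.01347 — 6 statements merged into one kernel-verified Lean document; each statement's English description precedes it below -/
import Mathlib

section
/- Let G be a simple graph on n vertices, let k ≥ 1 and let δ > 0. Suppose there exists an integer r ≥ 1 such that for every vertex v: (1) every vertex of G is at distance at most r from v; and (2) the number of vertices at distance at most r − 1 from v is at most δ·n/k. Then G is (δ·n)-balanced for k players. -/
open Finset Filter

open scoped Classical in
/-- The set of players whose facility is (weakly) closest to vertex `v`
(graph distance, `⊤` when disconnected). -/
noncomputable def closestPlayers {n k : ℕ} (G : SimpleGraph (Fin n))
    (u : Fin k → Fin n) (v : Fin n) : Finset (Fin k) :=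
  Finset.univ.filter (fun i => ∀ j : Fin k, G.edist v (u i) ≤ G.edist v (u j))

/-- The score of player `i` in the facility placement `u`:
`∑_{v : i ∈ C_v} 1 / |C_v|`. -/
noncomputable def score {n k : ℕ} (G : SimpleGraph (Fin n))
    (u : Fin k → Fin n) (i : Fin k) : ℝ :=
  ∑ v : Fin n, if i ∈ closestPlayers G u v then ((closestPlayers G u v).card : ℝ)⁻¹ else 0

/-- A placement is `z`-balanced if every player's score is between `⌊n/k⌋ - z`
and `⌈n/k⌉ + z`. -/
def BalancedPlacement {n k : ℕ} (G : SimpleGraph (Fin n))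
    (u : Fin k → Fin n) (z : ℝ) : Prop :=
  ∀ i : Fin k, ((n / k : ℕ) : ℝ) - z ≤ score G u i ∧
    score G u i ≤ (((n + k - 1) / k : ℕ) : ℝ) + z

/-- A graph is `z`-balanced for `k` players if every placement of `k` facilities on
distinct vertices is `z`-balanced. -/
def IsBalanced (n k : ℕ) (G : SimpleGraph (Fin n)) (z : ℝ) : Prop :=
  ∀ u : Fin k → Fin n, Function.Injective u → BalancedPlacement G u z

/-- If every facility is at distance exactly `d` from `v`, every player is closest to `v`. -/
theorem closestPlayers_eq_univ {n k : ℕ} {G : SimpleGraph (Fin n)} {u : Fin k → Fin n}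
    {v : Fin n} {d : ℕ∞} (h : ∀ j, G.edist v (u j) = d) :
    closestPlayers G u v = Finset.univ := by
  ext i
  simp [closestPlayers, h]

/-- The score of a player differs from `n / k` by at most the number of vertices for which the
facilities are not all closest. -/
theorem abs_score_sub_le {n k : ℕ} (hk : 1 ≤ k) {G : SimpleGraph (Fin n)} {u : Fin k → Fin n}
    {A : Finset (Fin n)} (hA : ∀ v ∉ A, closestPlayers G u v = Finset.univ) (i : Fin k) :
    |score G u i - (n : ℝ) / k| ≤ A.card := by
  have hsum : score G u i - (n : ℝ) / k = ∑ v : Fin n,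
      ((if i ∈ closestPlayers G u v then ((closestPlayers G u v).card : ℝ)⁻¹ else 0)
        - (k : ℝ)⁻¹) := by
    simp [score, Finset.sum_sub_distrib, div_eq_mul_inv]
  have hcard : (A.card : ℝ) = ∑ v : Fin n, if v ∈ A then (1 : ℝ) else 0 := by simp
  rw [hsum, hcard]
  refine (Finset.abs_sum_le_sum_abs _ _).trans (Finset.sum_le_sum fun v _ => ?_)
  split_ifs with hi hv hv
  · have hc : (1 : ℝ) ≤ (closestPlayers G u v).card := by
      exact_mod_cast Finset.card_pos.mpr ⟨i, hi⟩
    exact abs_sub_le_of_nonneg_of_le (by positivity) (inv_le_one_of_one_le₀ hc) (by positivity)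
      (inv_le_one_of_one_le₀ (by exact_mod_cast hk))
  · simp [hA v hv]
  · exact abs_sub_le_of_nonneg_of_le le_rfl zero_le_one (by positivity)
      (inv_le_one_of_one_le₀ (by exact_mod_cast hk))
  · simp [hA v hv] at hi

theorem div_le_cast_ceilDiv (n : ℕ) {k : ℕ} (hk : 1 ≤ k) :
    (n : ℝ) / k ≤ (((n + k - 1) / k : ℕ) : ℝ) := by
  have hk0 : (0 : ℝ) < k := by exact_mod_cast hk
  rw [div_le_iff₀ hk0]
  have h : n ≤ (n + k - 1) / k * k := by
    have h1 := Nat.div_add_mod' (n + k - 1) k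
    have h2 := Nat.mod_lt (n + k - 1) hk
    omega
  exact_mod_cast h

open scoped Classical in
/-- If some `r ≥ 1` satisfies: every vertex is within distance `r` of every
vertex, and every vertex has at most `δn/k` vertices within distance `r - 1`, then `G` is
`δn`-balanced for `k` players. -/
theorem balanced_of_radius_conditions (n k : ℕ) (hk : 1 ≤ k) (δ : ℝ) (hδ : 0 < δ)
    (G : SimpleGraph (Fin n)) (r : ℕ) (hr : 1 ≤ r)
    (h1 : ∀ v w : Fin n, G.edist v w ≤ (r : ℕ∞))
    (h2 : ∀ v : Fin n,
      ((Finset.univ.filter (fun w : Fin n => G.edist v w ≤ ((r - 1 : ℕ) : ℕ∞))).card : ℝ)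
        ≤ δ * n / k) :
    IsBalanced n k G (δ * n) := by
  intro u _ i
  have hk0 : (0 : ℝ) < k := by exact_mod_cast hk
  let A : Finset (Fin n) := Finset.univ.biUnion fun j : Fin k =>
    Finset.univ.filter fun w => G.edist (u j) w ≤ ((r - 1 : ℕ) : ℕ∞)
  have hcard : (A.card : ℝ) ≤ δ * n := by
    calc (A.card : ℝ) ≤ ∑ j : Fin k, ((Finset.univ.filter fun w =>
          G.edist (u j) w ≤ ((r - 1 : ℕ) : ℕ∞)).card : ℝ) := by
          exact_mod_cast Finset.card_biUnion_le
      _ ≤ ∑ _j : Fin k, δ * n / k := Finset.sum_le_sum fun j _ => h2 (u j)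
      _ = δ * n := by
          simp only [Finset.sum_const, Finset.card_univ, Fintype.card_fin, nsmul_eq_mul]
          field_simp
  have hA : ∀ v ∉ A, closestPlayers G u v = Finset.univ := by
    intro v hv
    refine closestPlayers_eq_univ (d := r) fun j => le_antisymm (h1 _ _) ?_
    have hj : ((r - 1 : ℕ) : ℕ∞) < G.edist v (u j) := by
      rw [SimpleGraph.edist_comm]
      by_contra hle
      exact hv (Finset.mem_biUnion.mpr ⟨j, Finset.mem_univ _,
        Finset.mem_filter.mpr ⟨Finset.mem_univ _, not_lt.mp hle⟩⟩)
    have := Order.add_one_le_of_lt hj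
    rwa [← Nat.cast_add_one, Nat.sub_add_cancel hr] at this
  obtain ⟨hlo, hhi⟩ := abs_le.mp ((abs_score_sub_le hk hA i).trans hcard)
  have hfloor : ((n / k : ℕ) : ℝ) ≤ (n : ℝ) / k := Nat.cast_div_le
  have hceil := div_le_cast_ceilDiv n hk
  constructor <;> linarith
end

section
/- Let G be the 12-vertex tree consisting of a center vertex c together with four disjoint paths (branches) of lengths 1, 2, 3, and 5 attached to c (i.e., one endpoint of each path is adjacent to c). Then no placement of two facilities on distinct vertices of G is 0-balanced; equivalently, for every placement of two facilities, the two players do not both have score 6. -/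
open Finset Filter

/-- The 12-vertex tree with center `0` and four paths of lengths 1, 2, 3, 5 attached to it:
branch `1`; branch `2 - 3`; branch `4 - 5 - 6`; branch `7 - 8 - 9 - 10 - 11`. -/
def fourBranchTree : SimpleGraph (Fin 12) :=
  SimpleGraph.fromEdgeSet
    {s(0, 1), s(0, 2), s(2, 3), s(0, 4), s(4, 5), s(5, 6),
     s(0, 7), s(7, 8), s(8, 9), s(9, 10), s(10, 11)}

/-- A function that vanishes only at `a`, changes by at most one along edges, and decreases along
some edge at every other vertex is the distance to `a`. -/
theorem edist_eq_of_lipschitz_of_descent {V : Type*} (G : SimpleGraph V) (a : V) (f : V → ℕ)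
    (hzero : f a = 0) (hlip : ∀ v w, G.Adj v w → f v ≤ f w + 1)
    (hdesc : ∀ v, v ≠ a → ∃ w, G.Adj v w ∧ f w + 1 = f v) (v : V) :
    G.edist v a = f v := by
  apply le_antisymm
  · have hwalk : ∀ n v, f v = n → ∃ p : G.Walk v a, p.length = n := by
      intro n
      induction n with
      | zero =>
        intro v hv
        by_cases hva : v = a
        · subst hva
          exact ⟨.nil, rfl⟩
        · obtain ⟨w, -, hw⟩ := hdesc v hva
          omega
      | succ n ih =>
        intro v hv
        have hva : v ≠ a := by
          rintro rfl
          omega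
        obtain ⟨w, hadj, hw⟩ := hdesc v hva
        obtain ⟨p, hp⟩ := ih w (by omega)
        exact ⟨.cons hadj p, by simp [hp]⟩
    obtain ⟨p, hp⟩ := hwalk _ v rfl
    rw [← hp]
    exact G.edist_le p
  · refine le_iInf fun p => ?_
    have hlen : ∀ {x y : V} (p : G.Walk x y), f x ≤ f y + p.length := by
      intro x y p
      induction p with
      | nil => simp
      | cons h p ih =>
        have := hlip _ _ h
        simp only [SimpleGraph.Walk.length_cons]
        omega
    have := hlen p
    rw [hzero, zero_add] at this
    exact_mod_cast this

/-- The distance from the center of the four-branch tree. -/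
def treeDepth : Fin 12 → ℕ := ![0, 1, 1, 2, 1, 2, 3, 1, 2, 3, 4, 5]

/-- The branch containing a vertex of the four-branch tree; the center forms its own branch. -/
def treeBranch : Fin 12 → ℕ := ![0, 1, 2, 2, 3, 3, 3, 4, 4, 4, 4, 4]

/-- The distance in the four-branch tree in terms of depths and branches. -/
def treeDist (v w : Fin 12) : ℕ :=
  if treeBranch v = treeBranch w then
    (treeDepth v - treeDepth w) + (treeDepth w - treeDepth v)
  else treeDepth v + treeDepth w

theorem fourBranchTree_adj_iff (v w : Fin 12) :
    fourBranchTree.Adj v w ↔ treeDist v w = 1 := by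
  simp only [fourBranchTree, SimpleGraph.fromEdgeSet_adj, Set.mem_insert_iff,
    Set.mem_singleton_iff]
  revert v w
  decide +kernel

theorem fourBranchTree_edist (v a : Fin 12) : fourBranchTree.edist v a = treeDist v a := by
  refine edist_eq_of_lipschitz_of_descent _ a (treeDist · a) ?_ ?_ ?_ v
  · simp [treeDist]
  · simp only [fourBranchTree_adj_iff]
    revert a
    decide +kernel
  · simp only [fourBranchTree_adj_iff]
    revert a
    decide +kernel

/-- With two players, the first one gains one unit from each vertex strictly closer to it and
half a unit from each tied vertex. -/
theorem two_mul_score_zero {n : ℕ} (G : SimpleGraph (Fin n)) (u : Fin 2 → Fin n)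
    (d : Fin n → Fin n → ℕ) (hd : ∀ v a, G.edist v a = d v a) :
    2 * score G u 0 = ((∑ v, if d v (u 0) < d v (u 1) then 2
      else if d v (u 0) = d v (u 1) then 1 else 0 : ℕ) : ℝ) := by
  rw [score, Finset.mul_sum, Nat.cast_sum]
  refine Finset.sum_congr rfl fun v _ => ?_
  rcases lt_trichotomy (d v (u 0)) (d v (u 1)) with h | h | h
  · have hC : closestPlayers G u v = {0} := by
      ext i
      fin_cases i <;> simp [closestPlayers, hd, Fin.forall_fin_two, h, h.le]
    simp [hC, h]
  · have hC : closestPlayers G u v = Finset.univ := by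
      ext i
      fin_cases i <;> simp [closestPlayers, hd, Fin.forall_fin_two, h]
    simp [hC, h]
  · have hC : closestPlayers G u v = {1} := by
      ext i
      fin_cases i <;> simp [closestPlayers, hd, Fin.forall_fin_two, h, h.le]
    simp [hC, h.not_gt, h.ne']

theorem sum_treeDist_ne (a b : Fin 12) (hab : a ≠ b) :
    (∑ v, if treeDist v a < treeDist v b then 2
      else if treeDist v a = treeDist v b then 1 else 0) ≠ 12 := by
  revert a b
  decide +kernel

/-- No placement of two facilities on the four-branch tree is `0`-balanced;
equivalently, the two players never both have score `6`. -/
theorem fourBranchTree_not_zero_balanced (u : Fin 2 → Fin 12) (hu : Function.Injective u) :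
    ¬ BalancedPlacement fourBranchTree u 0 ∧
    ¬ (score fourBranchTree u 0 = 6 ∧ score fourBranchTree u 1 = 6) := by
  have hscore : score fourBranchTree u 0 ≠ 6 := by
    intro h
    have hsum := two_mul_score_zero fourBranchTree u treeDist fourBranchTree_edist
    rw [h] at hsum
    refine sum_treeDist_ne (u 0) (u 1) (hu.ne (by decide)) ?_
    have h12 : (2 : ℝ) * 6 = ((12 : ℕ) : ℝ) := by norm_num
    rw [h12] at hsum
    exact (Nat.cast_injective hsum).symm
  refine ⟨fun h => hscore ?_, fun h => hscore h.1⟩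
  obtain ⟨hl, hr⟩ := h 0
  norm_num at hl hr
  exact le_antisymm hr hl
end

section
/- Let G be a simple graph on n vertices, let u_1, …, u_k be a placement of k facilities, let m ≥ 0, and suppose there is a set W of at least n − m vertices such that every w ∈ W satisfies d(w,u_i) = d(w,u_j) for all i, j ∈ [k] (distances possibly ∞). Then the score of every player lies between (n − m)/k and m + (n − m)/k; in particular, the placement is m-balanced. -/
open Finset Filter

theorem closestPlayers_eq_univ_of_equidistant {n k : ℕ} (G : SimpleGraph (Fin n))
    (u : Fin k → Fin n) {v : Fin n}
    (h : ∀ i j : Fin k, G.edist v (u i) = G.edist v (u j)) :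
    closestPlayers G u v = Finset.univ :=
  Finset.filter_true_of_mem fun i _ j => (h i j).le

/-- The amount a single vertex contributes to a player's score lies in `[0, 1]`. -/
theorem score_term_mem_Icc {n k : ℕ} (G : SimpleGraph (Fin n))
    (u : Fin k → Fin n) (i : Fin k) (v : Fin n) :
    (if i ∈ closestPlayers G u v then ((closestPlayers G u v).card : ℝ)⁻¹ else 0) ∈
      Set.Icc (0 : ℝ) 1 := by
  split_ifs with h
  · exact ⟨by positivity, inv_le_one_of_one_le₀ (by exact_mod_cast Finset.card_pos.2 ⟨i, h⟩)⟩
  · simp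

/-- Equidistant vertices contribute `1 / k` each, and each of the others at most `1`. -/
theorem score_bounds_of_equidistant {n k : ℕ} (G : SimpleGraph (Fin n))
    (u : Fin k → Fin n) (W : Finset (Fin n))
    (heq : ∀ w ∈ W, ∀ i j : Fin k, G.edist w (u i) = G.edist w (u j)) (i : Fin k) :
    (W.card : ℝ) / k ≤ score G u i ∧
      score G u i ≤ (W.card : ℝ) / k + ((n : ℝ) - W.card) := by
  have hterm := score_term_mem_Icc G u i
  have hWsum : ∑ v ∈ W, (if i ∈ closestPlayers G u v then
      ((closestPlayers G u v).card : ℝ)⁻¹ else 0) = (W.card : ℝ) / k := by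
    rw [Finset.sum_congr rfl (g := fun _ => (k : ℝ)⁻¹), Finset.sum_const, nsmul_eq_mul,
      div_eq_mul_inv]
    intro v hv
    simp [closestPlayers_eq_univ_of_equidistant G u (heq v hv)]
  have hcard : ((Wᶜ).card : ℝ) = (n : ℝ) - W.card := by
    rw [Finset.card_compl, Fintype.card_fin, Nat.cast_sub (card_finset_fin_le W)]
  rw [score, ← Finset.sum_add_sum_compl W, hWsum]
  constructor
  · exact le_add_of_nonneg_right (Finset.sum_nonneg fun v _ => (hterm v).1)
  · rw [← hcard]
    gcongr
    simpa using Finset.sum_le_card_nsmul (Wᶜ) _ (1 : ℝ) fun v _ => (hterm v).2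

/-- If at least `n - m` vertices are equidistant (possibly at distance `⊤`)
from all `k` facilities, then every player's score lies between `(n-m)/k` and
`m + (n-m)/k`; in particular the placement is `m`-balanced. -/
theorem balanced_of_equidistant_set (n k m : ℕ) (hk : 1 ≤ k) (G : SimpleGraph (Fin n))
    (u : Fin k → Fin n) (hu : Function.Injective u) (W : Finset (Fin n))
    (hW : (n : ℝ) - m ≤ (W.card : ℝ))
    (heq : ∀ w ∈ W, ∀ i j : Fin k, G.edist w (u i) = G.edist w (u j)) :
    (∀ i : Fin k,
      ((n : ℝ) - m) / k ≤ score G u i ∧ score G u i ≤ (m : ℝ) + ((n : ℝ) - m) / k) ∧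
    BalancedPlacement G u (m : ℝ) := by
  have hk1 : (1 : ℝ) ≤ k := by exact_mod_cast hk
  have hk0 : (0 : ℝ) < k := by linarith
  have hbounds : ∀ i : Fin k, ((n : ℝ) - m) / k ≤ score G u i ∧
      score G u i ≤ (m : ℝ) + ((n : ℝ) - m) / k := by
    intro i
    obtain ⟨hlow, hupp⟩ := score_bounds_of_equidistant G u W heq i
    refine ⟨le_trans (by gcongr) hlow, hupp.trans ?_⟩
    have hdiff : ((W.card : ℝ) - (n - m)) / k ≤ (W.card : ℝ) - (n - m) :=
      div_le_self (by linarith) hk1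
    rw [sub_div] at hdiff
    linarith
  refine ⟨hbounds, fun i => ?_⟩
  obtain ⟨hlow, hupp⟩ := hbounds i
  have hm : (m : ℝ) / k ≤ m := div_le_self (by positivity) hk1
  have hm0 : (0 : ℝ) ≤ (m : ℝ) / k := by positivity
  rw [sub_div] at hlow hupp
  have hfloor : ((n / k : ℕ) : ℝ) ≤ (n : ℝ) / k := Nat.cast_div_le
  have hceil : (n : ℝ) / k ≤ ((n + k - 1) / k : ℕ) := by
    rw [div_le_iff₀ hk0]
    have hlt := Nat.lt_mul_div_succ (n + k - 1) hk
    rw [mul_add, mul_one, mul_comm] at hlt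
    exact_mod_cast (by omega : n ≤ (n + k - 1) / k * k)
  constructor <;> linarith
end

section
/- Let G be a d-regular simple graph on n vertices (d ≥ 1) whose adjacency matrix has eigenvalues λ_1 ≥ λ_2 ≥ … ≥ λ_n, and suppose max(λ_2, |λ_n|) ≤ λ. Then for every vertex v, the number of vertices at graph distance strictly greater than 2 from v is at most λ²·n²/d³. -/
open Finset Filter

open scoped Classical in
theorem adjMatrix_isHermitian {n : ℕ} (G : SimpleGraph (Fin n)) :
    (G.adjMatrix ℝ).IsHermitian := by
  rw [Matrix.IsHermitian, Matrix.conjTranspose_eq_transpose_of_trivial]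
  exact G.isSymm_adjMatrix

open scoped Classical in
/-- `eigDesc G j` is the `(j+1)`-st largest eigenvalue (with multiplicity) of the
adjacency matrix of `G`, i.e. `eigDesc G 0 = λ₁ ≥ eigDesc G 1 = λ₂ ≥ …` and
`eigDesc G (n-1) = λₙ`; it is `0` for `j ≥ n`. -/
noncomputable def eigDesc {n : ℕ} (G : SimpleGraph (Fin n)) (j : ℕ) : ℝ :=
  if h : j < n then
    (adjMatrix_isHermitian G).eigenvalues
      (Tuple.sort ((adjMatrix_isHermitian G).eigenvalues) (Fin.rev ⟨j, h⟩))
  else 0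

open Matrix in
/-- The expander mixing lemma for a real symmetric matrix with constant row sums `r`. -/
theorem Matrix.IsHermitian.sq_dotProduct_mulVec_sub_le {ι : Type*} [Fintype ι] [DecidableEq ι]
    {A : Matrix ι ι ℝ} (hA : A.IsHermitian) {r lam : ℝ} (hr : A *ᵥ 1 = r • 1) (hlam : lam < r)
    (i₀ : ι) (h : ∀ i, i ≠ i₀ → |hA.eigenvalues i| ≤ lam) (x y : ι → ℝ) :
    (x ⬝ᵥ A *ᵥ y - r * (x ⬝ᵥ 1) * (1 ⬝ᵥ y) / Fintype.card ι) ^ 2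
      ≤ lam ^ 2 * (x ⬝ᵥ x) * (y ⬝ᵥ y) := by
  set e : ι → ι → ℝ := fun i => hA.eigenvectorBasis i with he
  have parseval (x y : ι → ℝ) : ∑ i, (x ⬝ᵥ e i) * (e i ⬝ᵥ y) = x ⬝ᵥ y := by
    have := hA.eigenvectorBasis.sum_inner_mul_inner (WithLp.toLp 2 x) (WithLp.toLp 2 y)
    simp only [EuclideanSpace.inner_eq_star_dotProduct, star_trivial] at this
    simpa only [he, dotProduct_comm] using this
  have eigen (i : ι) (y : ι → ℝ) : e i ⬝ᵥ A *ᵥ y = hA.eigenvalues i * (e i ⬝ᵥ y) := by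
    have hsymm : Aᵀ = A := by simpa using hA.eq
    rw [dotProduct_mulVec, ← mulVec_transpose, hsymm, hA.mulVec_eigenvectorBasis i,
      smul_dotProduct, smul_eq_mul]
  have orth (i : ι) : (hA.eigenvalues i - r) * (e i ⬝ᵥ 1) = 0 := by
    have := eigen i 1
    rw [hr, dotProduct_smul, smul_eq_mul] at this
    linarith
  have orth_of_ne (i : ι) (hi : i ≠ i₀) : e i ⬝ᵥ 1 = 0 := by
    refine (mul_eq_zero.mp (orth i)).resolve_left (ne_of_lt ?_)
    linarith [(abs_le.mp (h i hi)).2]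
  have one_dot (y : ι → ℝ) : 1 ⬝ᵥ y = (e i₀ ⬝ᵥ 1) * (e i₀ ⬝ᵥ y) := by
    rw [← parseval, Finset.sum_eq_single i₀]
    · rw [dotProduct_comm 1]
    · intro i _ hi
      rw [dotProduct_comm, orth_of_ne i hi, zero_mul]
    · simp
  have hcard : (Fintype.card ι : ℝ) = (e i₀ ⬝ᵥ 1) ^ 2 := by
    rw [sq, ← one_dot]
    simp [dotProduct]
  have hc : e i₀ ⬝ᵥ 1 ≠ 0 := by
    have : (Fintype.card ι : ℝ) ≠ 0 := by
      have : Nonempty ι := ⟨i₀⟩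
      exact_mod_cast Fintype.card_ne_zero
    rw [hcard] at this
    exact fun h0 => this (by simp [h0])
  have htop : hA.eigenvalues i₀ = r := by
    linarith [(mul_eq_zero.mp (orth i₀)).resolve_right hc]
  have hdiff : x ⬝ᵥ A *ᵥ y - r * (x ⬝ᵥ 1) * (1 ⬝ᵥ y) / Fintype.card ι
      = ∑ i ∈ Finset.univ.erase i₀, (hA.eigenvalues i * (x ⬝ᵥ e i)) * (e i ⬝ᵥ y) := by
    rw [← parseval, ← Finset.add_sum_erase _ _ (Finset.mem_univ i₀), hcard, dotProduct_comm x 1,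
      one_dot, one_dot, dotProduct_comm x, eigen, htop]
    simp only [eigen]
    have hsum : ∀ i, (x ⬝ᵥ e i) * (hA.eigenvalues i * (e i ⬝ᵥ y))
        = (hA.eigenvalues i * (x ⬝ᵥ e i)) * (e i ⬝ᵥ y) := fun i => by ring
    simp only [hsum]
    field_simp
    ring
  have norm_le (z : ι → ℝ) : ∑ i ∈ Finset.univ.erase i₀, (e i ⬝ᵥ z) ^ 2 ≤ z ⬝ᵥ z := by
    rw [← parseval z z]
    simp only [dotProduct_comm z, ← sq]
    exact Finset.sum_le_sum_of_subset_of_nonneg (Finset.erase_subset _ _)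
      fun i _ _ => sq_nonneg _
  have hx : ∑ i ∈ Finset.univ.erase i₀, (hA.eigenvalues i * (x ⬝ᵥ e i)) ^ 2
      ≤ lam ^ 2 * (x ⬝ᵥ x) := by
    refine le_trans ?_ (mul_le_mul_of_nonneg_left (norm_le x) (sq_nonneg lam))
    rw [Finset.mul_sum]
    refine Finset.sum_le_sum fun i hi => ?_
    rw [mul_pow, dotProduct_comm x]
    exact mul_le_mul_of_nonneg_right
      (sq_le_sq.mpr ((h i (Finset.ne_of_mem_erase hi)).trans (le_abs_self lam))) (sq_nonneg _)
  rw [hdiff]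
  exact (Finset.sum_mul_sq_le_sq_mul_sq _ _ _).trans (mul_le_mul hx (norm_le y)
    (Finset.sum_nonneg fun i _ => sq_nonneg _)
    ((Finset.sum_nonneg fun i _ => sq_nonneg _).trans hx))

/-- All eigenvalues of the adjacency matrix but one are at most `max (λ₂, |λₙ|)` in absolute
value. -/
theorem exists_forall_ne_abs_eigenvalues_le {n : ℕ} (hn : 2 ≤ n) (G : SimpleGraph (Fin n)) :
    ∃ i₀, ∀ i, i ≠ i₀ → |(adjMatrix_isHermitian G).eigenvalues i|
      ≤ max (eigDesc G 1) |eigDesc G (n - 1)| := by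
  set f := (adjMatrix_isHermitian G).eigenvalues
  have mono := Tuple.monotone_sort f
  refine ⟨Tuple.sort f (Fin.rev ⟨0, by omega⟩), fun i hi => ?_⟩
  obtain ⟨j, rfl⟩ := (Tuple.sort f).surjective i
  have hj : j ≠ Fin.rev ⟨0, by omega⟩ := fun h => hi (h ▸ rfl)
  have hj1 : j ≤ Fin.rev ⟨1, by omega⟩ := by
    simp only [ne_eq, Fin.ext_iff, Fin.le_def, Fin.val_rev] at hj ⊢
    omega
  have hjn : Fin.rev ⟨n - 1, by omega⟩ ≤ j := by
    simp only [Fin.le_def, Fin.val_rev]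
    omega
  have hup : f (Tuple.sort f j) ≤ eigDesc G 1 := by
    rw [eigDesc, dif_pos (by omega)]
    exact mono hj1
  have hlow : eigDesc G (n - 1) ≤ f (Tuple.sort f j) := by
    rw [eigDesc, dif_pos (by omega)]
    exact mono hjn
  rw [abs_le]
  constructor
  · linarith [neg_abs_le (eigDesc G (n - 1)), le_max_right (eigDesc G 1) |eigDesc G (n - 1)|]
  · exact hup.trans (le_max_left _ _)

open Matrix in
open scoped Classical in
/-- In a `d`-regular graph with `max (λ₂, |λₙ|) ≤ lam < d`, two vertex sets with no edge between
them satisfy `d² |S| |T| ≤ lam² n²`. -/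
theorem sq_mul_card_mul_card_le_of_forall_not_adj {n d : ℕ} (hn : 2 ≤ n) (G : SimpleGraph (Fin n))
    (hreg : G.IsRegularOfDegree d) {lam : ℝ} (hlam : max (eigDesc G 1) |eigDesc G (n - 1)| ≤ lam)
    (hlt : lam < d) (S T : Finset (Fin n)) (hST : ∀ s ∈ S, ∀ t ∈ T, ¬ G.Adj s t) :
    (d : ℝ) ^ 2 * S.card * T.card ≤ lam ^ 2 * (n : ℝ) ^ 2 := by
  obtain ⟨i₀, hi₀⟩ := exists_forall_ne_abs_eigenvalues_le hn G
  have hrow : G.adjMatrix ℝ *ᵥ 1 = (d : ℝ) • 1 := by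
    ext w
    simp [SimpleGraph.adjMatrix_mulVec_apply, hreg w]
  have hmix := (adjMatrix_isHermitian G).sq_dotProduct_mulVec_sub_le hrow hlt i₀
    (fun i hi => (hi₀ i hi).trans hlam)
    (fun w => if w ∈ S then 1 else 0) (fun w => if w ∈ T then 1 else 0)
  have hcross : (fun w => if w ∈ S then (1 : ℝ) else 0) ⬝ᵥ
      G.adjMatrix ℝ *ᵥ (fun w => if w ∈ T then 1 else 0) = 0 := by
    refine Finset.sum_eq_zero fun s _ => ?_
    by_cases hs : s ∈ S
    · rw [SimpleGraph.adjMatrix_mulVec_apply, Finset.sum_eq_zero, mul_zero]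
      intro w hw
      exact if_neg fun hwT => hST s hs w hwT ((G.mem_neighborFinset s w).mp hw)
    · simp [hs]
  rw [hcross] at hmix
  simp only [dotProduct, Pi.one_apply, mul_one, mul_ite, mul_zero,
    Finset.sum_ite_mem, Finset.univ_inter, Finset.sum_const, nsmul_eq_mul, Fintype.card_fin,
    Finset.inter_self, zero_sub, neg_sq] at hmix
  have hn0 : (0 : ℝ) < n := by exact_mod_cast (by omega : 0 < n)
  rw [div_pow, div_le_iff₀ (by positivity)] at hmix
  rcases (by positivity : (0 : ℝ) ≤ S.card * T.card).eq_or_lt' with h0 | hpos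
  · rw [mul_assoc, h0, mul_zero]
    positivity
  · refine le_of_mul_le_mul_right ?_ hpos
    linarith

open scoped Classical in
/-- If `G` is `d`-regular on `n` vertices with `max (λ₂, |λₙ|) ≤ λ`, then for
every vertex `v` the number of vertices at distance strictly greater than `2` from `v` is at
most `λ² n² / d³`. -/
theorem distance_gt_two_bound (n d : ℕ) (hn : 2 ≤ n) (hd : 1 ≤ d)
    (G : SimpleGraph (Fin n)) (hreg : G.IsRegularOfDegree d) (lam : ℝ)
    (hlam : max (eigDesc G 1) |eigDesc G (n - 1)| ≤ lam) :
    ∀ v : Fin n,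
      ((Finset.univ.filter (fun w : Fin n => (2 : ℕ∞) < G.edist v w)).card : ℝ)
        ≤ lam ^ 2 * (n : ℝ) ^ 2 / (d : ℝ) ^ 3 := by
  intro v
  set T := Finset.univ.filter (fun w : Fin n => (2 : ℕ∞) < G.edist v w) with hT
  have hd0 : (0 : ℝ) < d := by exact_mod_cast hd
  have hdn : (d : ℝ) ≤ n := by
    have := (G.degree_lt_card_verts v).le
    rw [hreg v, Fintype.card_fin] at this
    exact_mod_cast this
  have hTn : (T.card : ℝ) ≤ n := by
    exact_mod_cast (Finset.card_le_univ T).trans_eq (Fintype.card_fin n)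
  rw [le_div_iff₀ (by positivity)]
  rcases le_or_gt (d : ℝ) lam with hlarge | hsmall
  · calc (T.card : ℝ) * d ^ 3 = d ^ 2 * (T.card * d) := by ring
      _ ≤ lam ^ 2 * (n * n) := by gcongr
      _ = lam ^ 2 * n ^ 2 := by ring
  · have hcard : (G.neighborFinset v).card = d := hreg v
    have := sq_mul_card_mul_card_le_of_forall_not_adj hn G hreg hlam hsmall (G.neighborFinset v) T
      fun s hs w hw hadj => by
        have hlt : 2 < G.edist v w := by simpa [hT] using hw
        rw [SimpleGraph.mem_neighborFinset] at hs
        exact absurd (SimpleGraph.Walk.cons hs (.cons hadj .nil)).edist_le (not_le.mpr hlt)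
    rw [hcard] at this
    linarith
end

section
/- Let n ≥ 3 and let P_n be the path graph with vertices v_1, …, v_n and edges {v_i, v_{i+1}} for i ∈ [n−1]. For the placement of two facilities on v_1 and v_2, the player at v_1 has score exactly 1 and the player at v_2 has score exactly n − 1; consequently, P_n is not z-balanced for 2 players for any z < ⌊n/2⌋ − 1. -/
open Finset Filter

/-- The path graph on `Fin n` with vertices `v_1, …, v_n` (`v_i` is `⟨i-1, _⟩`) and edges
`{v_i, v_{i+1}}`. -/
def pathG (n : ℕ) : SimpleGraph (Fin n) :=
  SimpleGraph.fromRel (fun a b => (a : ℕ) + 1 = (b : ℕ))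

lemma pathG_adj_iff {n : ℕ} (a b : Fin n) :
    (pathG n).Adj a b ↔ (a : ℕ) + 1 = b ∨ (b : ℕ) + 1 = a := by
  simp only [pathG, SimpleGraph.fromRel_adj, ne_eq, Fin.ext_iff]
  omega

lemma le_add_length_of_walk_pathG {n : ℕ} {a b : Fin n} (p : (pathG n).Walk a b) :
    (a : ℕ) ≤ b + p.length := by
  induction p with
  | nil => simp
  | cons h p ih =>
    rw [pathG_adj_iff] at h
    rw [SimpleGraph.Walk.length_cons]
    omega

lemma exists_walk_pathG {n : ℕ} (d : ℕ) (a b : Fin n) (h : (a : ℕ) = b + d) :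
    ∃ p : (pathG n).Walk a b, p.length = d := by
  induction d generalizing a with
  | zero =>
    obtain rfl : a = b := Fin.ext h
    exact ⟨.nil, rfl⟩
  | succ d ih =>
    obtain ⟨p, hp⟩ := ih ⟨b + d, by omega⟩ rfl
    exact ⟨.cons ((pathG_adj_iff _ _).2 (Or.inr (by simp only; omega))) p, by simp [hp]⟩

/-- Along the path, `edist` is the difference of the indices. -/
lemma edist_pathG {n : ℕ} {a b : Fin n} (h : b ≤ a) :
    (pathG n).edist a b = ((a - b : ℕ) : ℕ∞) := by
  have hba : (b : ℕ) ≤ a := h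
  apply le_antisymm
  · obtain ⟨p, hp⟩ := exists_walk_pathG (a - b : ℕ) a b (by omega)
    exact (SimpleGraph.edist_le p).trans (by rw [hp])
  · refine le_iInf fun p => ?_
    have := le_add_length_of_walk_pathG p
    exact_mod_cast (by omega : (a - b : ℕ) ≤ p.length)

lemma closestPlayers_pathG_end {n : ℕ} (hn : 1 < n) (v : Fin n) :
    closestPlayers (pathG n) ![⟨0, by omega⟩, ⟨1, hn⟩] v =
      if (v : ℕ) = 0 then {0} else {1} := by
  ext i
  split_ifs with hv
  · obtain rfl : v = ⟨0, Nat.zero_lt_of_lt hn⟩ := Fin.ext hv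
    fin_cases i <;> simp [closestPlayers, Fin.forall_fin_two]
  · have h0 : (pathG n).edist v ⟨0, by omega⟩ = ((v - 0 : ℕ) : ℕ∞) :=
      edist_pathG (Fin.mk_le_of_le_val (by omega))
    have h1 : (pathG n).edist v ⟨1, hn⟩ = ((v - 1 : ℕ) : ℕ∞) :=
      edist_pathG (Fin.mk_le_of_le_val (by omega))
    fin_cases i <;>
      simp only [closestPlayers, Fin.forall_fin_two, mem_filter, mem_univ, true_and,
        Matrix.cons_val_zero, Matrix.cons_val_one, Fin.zero_eta, Fin.mk_one, h0, h1,
        Nat.cast_le, mem_singleton] <;> simp <;> omega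

lemma score_pathG_end_zero {n : ℕ} (hn : 1 < n) :
    score (pathG n) ![⟨0, by omega⟩, ⟨1, hn⟩] 0 = 1 := by
  simp only [score, closestPlayers_pathG_end hn]
  obtain ⟨m, rfl⟩ : ∃ m, n = m + 1 := ⟨n - 1, by omega⟩
  simp [Fin.sum_univ_succ]

lemma score_pathG_end_one {n : ℕ} (hn : 1 < n) :
    score (pathG n) ![⟨0, by omega⟩, ⟨1, hn⟩] 1 = (n : ℝ) - 1 := by
  simp only [score, closestPlayers_pathG_end hn]
  obtain ⟨m, rfl⟩ : ∃ m, n = m + 1 := ⟨n - 1, by omega⟩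
  simp [Fin.sum_univ_succ]

/-- For `n ≥ 3`, placing the two facilities on `v_1` and `v_2` of the path
`P_n` gives the first player score `1` and the second player score `n - 1`; consequently
`P_n` is not `z`-balanced for `2` players for any `z < ⌊n/2⌋ - 1`. -/
theorem path_end_placement_unbalanced (n : ℕ) (hn : 3 ≤ n) :
    score (pathG n) ![⟨0, by omega⟩, ⟨1, by omega⟩] 0 = 1 ∧
    score (pathG n) ![⟨0, by omega⟩, ⟨1, by omega⟩] 1 = (n : ℝ) - 1 ∧
    ∀ z : ℝ, z < ((n / 2 : ℕ) : ℝ) - 1 → ¬ IsBalanced n 2 (pathG n) z := by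
  have h0 := score_pathG_end_zero (n := n) (by omega)
  refine ⟨h0, score_pathG_end_one (by omega), fun z hz hbal => ?_⟩
  have hinj : Function.Injective
      (![⟨0, by omega⟩, ⟨1, by omega⟩] : Fin 2 → Fin n) := by
    simp [Function.Injective, Fin.forall_fin_two]
  have := (hbal _ hinj 0).1
  rw [h0] at this
  linarith
end

section
/- Let G be a connected simple graph, let v be a vertex of G of degree d_v, and consider the placement of k = d_v + 1 facilities, one on v and one on each neighbor of v. Then the score of the player whose facility is on v is exactly 1. Consequently, if G has n vertices then G is not z-balanced for d_v + 1 players for any z < ⌊n/(d_v+1)⌋ − 1. -/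
open Finset Filter

/-- A vertex reachable from `v` and different from it is strictly closer to some neighbor
of `v` than to `v`. -/
theorem SimpleGraph.Reachable.exists_adj_edist_lt {V : Type*} {G : SimpleGraph V} {v w : V}
    (h : G.Reachable v w) (hne : w ≠ v) : ∃ x, G.Adj v x ∧ G.edist w x < G.edist w v := by
  obtain ⟨p, hp⟩ := h.exists_walk_length_eq_edist
  cases p with
  | nil => exact absurd rfl hne
  | @cons _ x _ hadj q =>
    refine ⟨x, hadj, ?_⟩
    rw [G.edist_comm (u := w) (v := x), G.edist_comm (u := w) (v := v), ← hp]
    refine (SimpleGraph.edist_le q).trans_lt ?_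
    simp only [SimpleGraph.Walk.length_cons]
    exact_mod_cast Nat.lt_succ_self _

theorem mem_closestPlayers {n k : ℕ} {G : SimpleGraph (Fin n)} {u : Fin k → Fin n} {v : Fin n}
    {i : Fin k} : i ∈ closestPlayers G u v ↔ ∀ j, G.edist v (u i) ≤ G.edist v (u j) := by
  simp [closestPlayers]

/-- The only player closest to an occupied vertex is the one occupying it. -/
theorem closestPlayers_apply {n k : ℕ} (G : SimpleGraph (Fin n)) {u : Fin k → Fin n}
    (hu : Function.Injective u) (i : Fin k) : closestPlayers G u (u i) = {i} := by
  ext j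
  rw [mem_closestPlayers, Finset.mem_singleton]
  constructor
  · intro h
    have hi := h i
    rw [SimpleGraph.edist_self, nonpos_iff_eq_zero, SimpleGraph.edist_eq_zero_iff] at hi
    exact (hu hi).symm
  · rintro rfl l
    simp

/-- In a connected graph, a player all of whose neighboring vertices are occupied scores
exactly `1`. -/
theorem score_eq_one_of_neighbors_occupied {n k : ℕ} {G : SimpleGraph (Fin n)}
    (hconn : G.Connected) {u : Fin k → Fin n} (hu : Function.Injective u) {i : Fin k}
    (hocc : ∀ x, G.Adj (u i) x → ∃ j, u j = x) : score G u i = 1 := by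
  rw [score, Finset.sum_eq_single (u i)]
  · simp [closestPlayers_apply G hu]
  · intro w _ hw
    refine if_neg fun hmem => ?_
    obtain ⟨x, hx, hlt⟩ := (hconn.preconnected (u i) w).exists_adj_edist_lt hw
    obtain ⟨j, rfl⟩ := hocc x hx
    exact (mem_closestPlayers.1 hmem j).not_gt hlt
  · simp

/-- An injective map from `Fin (G.degree v + 1)` sending every nonzero index to a neighbor of
`v` hits every neighbor of `v`. -/
theorem exists_apply_eq_of_adj {V : Type*} {G : SimpleGraph V} {v : V}
    [Fintype (G.neighborSet v)] {u : Fin (G.degree v + 1) → V} (hu : Function.Injective u)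
    (hadj : ∀ i, i ≠ 0 → G.Adj v (u i)) {x : V} (hx : G.Adj v x) : ∃ i, u i = x := by
  let f : Fin (G.degree v) → G.neighborSet v := fun i => ⟨u i.succ, hadj _ i.succ_ne_zero⟩
  have hf : Function.Injective f := fun i j h =>
    Fin.succ_injective _ (hu (congrArg Subtype.val h))
  have hbij : Function.Bijective f :=
    (Fintype.bijective_iff_injective_and_card f).2 ⟨hf, by
      rw [Fintype.card_fin, G.card_neighborSet_eq_degree]⟩
  obtain ⟨i, hi⟩ := hbij.surjective ⟨x, hx⟩
  exact ⟨i.succ, congrArg Subtype.val hi⟩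

/-- The vertex `v` and its neighbors can be enumerated by `Fin (G.degree v + 1)`,
starting with `v`. -/
theorem exists_closed_neighborhood_placement {V : Type*} (G : SimpleGraph V) (v : V)
    [Fintype (G.neighborSet v)] :
    ∃ u : Fin (G.degree v + 1) → V, Function.Injective u ∧ u 0 = v ∧
      ∀ i, i ≠ 0 → G.Adj v (u i) := by
  let e : Fin (G.degree v) ≃ G.neighborSet v :=
    (Fintype.equivFinOfCardEq (G.card_neighborSet_eq_degree v)).symm
  refine ⟨Fin.cons v fun i => (e i : V), Fin.cons_injective_iff.2 ⟨?_, ?_⟩, rfl, ?_⟩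
  · rintro ⟨i, hi⟩
    exact G.ne_of_adj (e i).2 hi.symm
  · exact Subtype.val_injective.comp e.injective
  · intro i hi
    obtain ⟨j, rfl⟩ := Fin.exists_succ_eq.2 hi
    exact (e j).2

open scoped Classical in
/-- In a connected graph, placing `d_v + 1` facilities on a vertex `v` and on
all of its neighbors gives the player at `v` score exactly `1`; consequently `G` is not
`z`-balanced for `d_v + 1` players for any `z < ⌊n/(d_v+1)⌋ - 1`. -/
theorem surrounded_vertex_score_one (n : ℕ) (G : SimpleGraph (Fin n))
    (hconn : G.Connected) (v : Fin n) :
    (∀ u : Fin (G.degree v + 1) → Fin n, Function.Injective u → u 0 = v →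
      (∀ i : Fin (G.degree v + 1), i ≠ 0 → G.Adj v (u i)) → score G u 0 = 1) ∧
    (∀ z : ℝ, z < ((n / (G.degree v + 1) : ℕ) : ℝ) - 1 →
      ¬ IsBalanced n (G.degree v + 1) G z) := by
  have hscore : ∀ u : Fin (G.degree v + 1) → Fin n, Function.Injective u → u 0 = v →
      (∀ i : Fin (G.degree v + 1), i ≠ 0 → G.Adj v (u i)) → score G u 0 = 1 :=
    fun u hu h0 hadj => score_eq_one_of_neighbors_occupied hconn hu fun x hx =>
      exists_apply_eq_of_adj hu hadj (h0 ▸ hx)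
  refine ⟨hscore, fun z hz hbal => ?_⟩
  obtain ⟨u, hu, h0, hadj⟩ := exists_closed_neighborhood_placement G v
  have hle := (hbal u hu 0).1
  rw [hscore u hu h0 hadj] at hle
  linarith
end
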